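/- Let C be an admissible capacity on X and let μ₀ be a Borel measure on X that is essentially absolutely continuous with respect to C. For every Borel set E ⊆ X define μ(E) := inf{μ₀(D) : E ⊆ D ⊆ X, D q-open}. Then: μ is a countably additive Borel measure on X; μ₀(E) ≤ μ(E) for every Borel E; μ(Q) = μ₀(Q) for every q-open Q; for every q-open Q with μ₀(Q) < ∞ and every Borel set B one has μ(B ∩ Q) = μ₀(B ∩ Q); μ is q-perfect; and μ(E) ≤ ν(E) for every Borel E and every q-perfect Borel measure ν with μ₀ ≤ ν (so μ is the smallest q-perfect measure dominating μ₀). -/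

import Mathlib

open Set Metric Filter MeasureTheory ENNReal

noncomputable section

/-- A capacity on a metric space `X`: a monotone, countably subadditive
set function vanishing on the empty set, with values in `[0,∞]`. -/
structure Capacity (X : Type*) [MetricSpace X] where
  toFun : Set X → ℝ≥0∞
  empty' : toFun ∅ = 0
  mono' : ∀ ⦃A B : Set X⦄, A ⊆ B → toFun A ≤ toFun B
  subadd' : ∀ A : ℕ → Set X, toFun (⋃ n, A n) ≤ ∑' n, toFun (A n)

variable {X : Type*} [MetricSpace X]

/-- The set of `q`-thick points of `A`: points `ξ` where the series
`∑ (2^{nγ} C(A ∩ B̄(ξ,2^{-n})))^{q-1}` diverges. -/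
def Capacity.thick (C : Capacity X) (q γ : ℝ) (A : Set X) : Set X :=
  {ξ : X | ∑' n : ℕ,
    ((2 : ℝ≥0∞) ^ ((n : ℝ) * γ) * C.toFun (A ∩ closedBall ξ ((2 : ℝ) ^ (-(n : ℝ))))) ^ (q - 1) = ⊤}

/-- The `q`-fine closure of a set: `Ã = A ∪ b(A)`. -/
def Capacity.fineClosure (C : Capacity X) (q γ : ℝ) (A : Set X) : Set X :=
  A ∪ C.thick q γ A

/-- The `q`-fine interior of a set: `A° = A \ b(X∖A)`. -/
def Capacity.fineInterior (C : Capacity X) (q γ : ℝ) (A : Set X) : Set X :=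
  A \ C.thick q γ Aᶜ

/-- A set is `q`-closed if it contains all its `q`-thick points. -/
def Capacity.QClosed (C : Capacity X) (q γ : ℝ) (F : Set X) : Prop :=
  C.thick q γ F ⊆ F

/-- A set is `q`-open if its complement is `q`-closed. -/
def Capacity.QOpen (C : Capacity X) (q γ : ℝ) (A : Set X) : Prop :=
  C.QClosed q γ Aᶜ

/-- `A ⊆q B` : `A` is `q`-essentially contained in `B`, i.e. `C(A∖B) = 0`. -/
def Capacity.Subq (C : Capacity X) (A B : Set X) : Prop := C.toFun (A \ B) = 0

/-- `A ∼q B` : `A` and `B` are `q`-equivalent, i.e. `C(AΔB) = 0`. -/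
def Capacity.Eqq (C : Capacity X) (A B : Set X) : Prop :=
  C.toFun ((A \ B) ∪ (B \ A)) = 0

/-- A set `E` is `q`-quasi closed: there is an increasing sequence of compact
subsets `K m ⊆ E` with `C(E∖K m) → 0`. -/
def Capacity.QuasiClosed (C : Capacity X) (E : Set X) : Prop :=
  ∃ K : ℕ → Set X, Monotone K ∧ (∀ m, IsCompact (K m)) ∧ (∀ m, K m ⊆ E) ∧
    Tendsto (fun m => C.toFun (E \ K m)) atTop (nhds 0)

/-- An admissible capacity: all the regularity, Kellogg, stratification,
patching and quasi-Lindelöf properties of the Bessel capacity `C_{2/q,q'}`. -/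
structure Capacity.Admissible [CompactSpace X] [MeasurableSpace X] [BorelSpace X]
    (C : Capacity X) (q γ : ℝ) : Prop where
  finite : C.toFun univ ≠ ⊤
  outerRegular : ∀ E : Set X, C.toFun E = ⨅ (G : Set X) (_ : E ⊆ G) (_ : IsOpen G), C.toFun G
  contIncr : ∀ E : ℕ → Set X, Monotone E →
    Tendsto (fun i => C.toFun (E i)) atTop (nhds (C.toFun (⋃ i, E i)))
  contDecrCompact : ∀ K : ℕ → Set X, (∀ i, IsCompact (K i)) → Antitone K →
    Tendsto (fun i => C.toFun (K i)) atTop (nhds (C.toFun (⋂ i, K i)))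
  innerRegular : ∀ E : Set X, MeasurableSet E →
    C.toFun E = ⨆ (K : Set X) (_ : K ⊆ E) (_ : IsCompact K), C.toFun K
  kellogg : ∀ A : Set X, C.toFun (A \ C.thick q γ A) = 0
  closureBound : ∃ c : ℝ≥0∞, 1 ≤ c ∧ c ≠ ⊤ ∧
    ∀ A : Set X, C.toFun (C.fineClosure q γ A) ≤ c * C.toFun A
  closureQClosed : ∀ A : Set X, C.QClosed q γ (C.fineClosure q γ A)
  stratification : ∀ E : Set X, C.QClosed q γ E → C.QuasiClosed E
  thickQuasi : ∀ E : Set X, C.QuasiClosed E → C.toFun (C.thick q γ E \ E) = 0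
  openPatch : ∀ D : Set X, C.QOpen q γ D → ∀ ε : ℝ≥0∞, 0 < ε →
    ∃ ω : Set X, IsOpen ω ∧ C.toFun ω < ε ∧ IsOpen (D ∪ ω)
  quasiLindelof : ∀ 𝒟 : Set (Set X), (∀ D ∈ 𝒟, C.QOpen q γ D) →
    ∃ 𝒟' ⊆ 𝒟, 𝒟'.Countable ∧ C.toFun ((⋃₀ 𝒟) \ ⋃₀ 𝒟') = 0

/-- A Borel measure is outer regular with respect to the `q`-topology. -/
def Capacity.OuterRegularQ [MeasurableSpace X] (C : Capacity X) (q γ : ℝ) (μ : Measure X) : Prop :=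
  ∀ E : Set X, MeasurableSet E → μ E = ⨅ (Q : Set X) (_ : E ⊆ Q) (_ : C.QOpen q γ Q), μ Q

/-- A Borel measure is essentially absolutely continuous with respect to `C`. -/
def Capacity.EssAbsCont [MeasurableSpace X] (C : Capacity X) (q γ : ℝ) (μ : Measure X) : Prop :=
  ∀ Q : Set X, C.QOpen q γ Q → ∀ A : Set X, MeasurableSet A → C.toFun A = 0 → μ (Q \ A) = μ Q

/-- A `q`-perfect measure: outer regular w.r.t. the `q`-topology and
essentially absolutely continuous w.r.t. `C`. -/
def Capacity.QPerfect [MeasurableSpace X] (C : Capacity X) (q γ : ℝ) (μ : Measure X) : Prop :=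
  C.OuterRegularQ q γ μ ∧ C.EssAbsCont q γ μ

namespace Capacity

/-- A capacity, bundled as an outer measure. -/
def toOuterMeasure (C : Capacity X) : OuterMeasure X where
  measureOf := C.toFun
  empty := C.empty'
  mono {_ _} h := C.mono' h
  iUnion_nat s _ := C.subadd' s

theorem union_le (C : Capacity X) (A B : Set X) : C.toFun (A ∪ B) ≤ C.toFun A + C.toFun B :=
  measure_union_le (μ := C.toOuterMeasure) A B

theorem le_add_of_subset_union (C : Capacity X) {A B D : Set X} (h : A ⊆ B ∪ D) :
    C.toFun A ≤ C.toFun B + C.toFun D :=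
  (C.mono' h).trans (C.union_le B D)

theorem thick_subset_of_subq (C : Capacity X) {q : ℝ} (γ : ℝ) (hq : 1 ≤ q) {A B : Set X}
    (h : C.Subq A B) : C.thick q γ A ⊆ C.thick q γ B := by
  intro ξ hξ
  refine top_le_iff.1 (hξ.symm.le.trans (ENNReal.tsum_le_tsum fun n => ?_))
  refine ENNReal.rpow_le_rpow (mul_le_mul_right ?_ _) (sub_nonneg.2 hq)
  set S := closedBall ξ ((2 : ℝ) ^ (-(n : ℝ)))
  have hsub : A ∩ S ⊆ (B ∩ S) ∪ (A \ B) := fun x hx => by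
    by_cases hB : x ∈ B
    · exact Or.inl ⟨hB, hx.2⟩
    · exact Or.inr ⟨hx.1, hB⟩
  simpa [show C.toFun (A \ B) = 0 from h] using C.le_add_of_subset_union hsub

theorem thick_mono (C : Capacity X) {q : ℝ} (γ : ℝ) (hq : 1 ≤ q) {A B : Set X} (h : A ⊆ B) :
    C.thick q γ A ⊆ C.thick q γ B :=
  C.thick_subset_of_subq γ hq (by simp [Subq, sdiff_eq_empty.2 h, C.empty'])

theorem thick_union_subset (C : Capacity X) {q : ℝ} (γ : ℝ) (hq : 1 ≤ q) (A B : Set X) :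
    C.thick q γ (A ∪ B) ⊆ C.thick q γ A ∪ C.thick q γ B := by
  have hp : 0 ≤ q - 1 := sub_nonneg.2 hq
  have key (a b : ℝ≥0∞) : (a + b) ^ (q - 1) ≤ 2 ^ (q - 1) * (a ^ (q - 1) + b ^ (q - 1)) := by
    rw [mul_add, ← ENNReal.mul_rpow_of_nonneg _ _ hp, ← ENNReal.mul_rpow_of_nonneg _ _ hp]
    rcases le_total a b with h | h
    · exact (ENNReal.rpow_le_rpow (by rw [two_mul]; gcongr) hp).trans le_add_self
    · exact (ENNReal.rpow_le_rpow (by rw [two_mul]; gcongr) hp).trans le_self_add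
  intro ξ hξ
  by_contra hcon
  simp only [mem_union, not_or] at hcon
  obtain ⟨hA, hB⟩ := hcon
  have hfin := ENNReal.mul_ne_top (ENNReal.rpow_ne_top_of_nonneg hp (ENNReal.ofNat_ne_top (n := 2)))
    (ENNReal.add_ne_top.2 ⟨hA, hB⟩)
  rw [← ENNReal.tsum_add, ← ENNReal.tsum_mul_left] at hfin
  refine hfin (top_le_iff.1 (hξ.symm.le.trans (ENNReal.tsum_le_tsum fun n => ?_)))
  refine le_trans (ENNReal.rpow_le_rpow ?_ hp) (key _ _)
  rw [← mul_add, union_inter_distrib_right]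
  exact mul_le_mul_right (C.union_le _ _) _

theorem qClosed_of_isClosed (C : Capacity X) (hfin : C.toFun univ ≠ ⊤) {q : ℝ} (γ : ℝ)
    (hq : 1 < q) {F : Set X} (hF : IsClosed F) : C.QClosed q γ F := by
  intro ξ hξ
  by_contra hmem
  obtain ⟨ε, hε, hball⟩ := Metric.isOpen_iff.1 hF.isOpen_compl ξ hmem
  obtain ⟨k, hk⟩ := exists_pow_lt_of_lt_one hε (by norm_num : (2⁻¹ : ℝ) < 1)
  refine absurd hξ ?_
  change ¬ (_ = _)
  rw [tsum_eq_sum (s := Finset.range k)]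
  · refine ENNReal.sum_ne_top.2 fun n _ => ENNReal.rpow_ne_top_of_nonneg (by linarith) ?_
    refine ENNReal.mul_ne_top ?_ (ne_top_of_le_ne_top hfin (C.mono' (subset_univ _)))
    exact ENNReal.rpow_ne_top_of_ne_zero two_ne_zero ENNReal.ofNat_ne_top
  · intro n hn
    have hr : (2 : ℝ) ^ (-(n : ℝ)) < ε := by
      rw [Real.rpow_neg two_pos.le, Real.rpow_natCast, ← inv_pow]
      exact (pow_le_pow_of_le_one (by norm_num) (by norm_num)
        (not_lt.1 (mt Finset.mem_range.2 hn))).trans_lt hk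
    have hempty : F ∩ closedBall ξ ((2 : ℝ) ^ (-(n : ℝ))) = ∅ := by
      refine eq_empty_of_forall_notMem fun x hx => hball ?_ hx.1
      exact closedBall_subset_ball hr hx.2
    rw [hempty, C.empty', mul_zero, ENNReal.zero_rpow_of_pos (by linarith)]

theorem QOpen.iUnion {C : Capacity X} {q γ : ℝ} (hq : 1 ≤ q) {ι : Sort*} {D : ι → Set X}
    (hD : ∀ i, C.QOpen q γ (D i)) : C.QOpen q γ (⋃ i, D i) := by
  intro ξ hξ
  rw [compl_iUnion] at hξ ⊢
  exact mem_iInter.2 fun i => hD i (C.thick_mono γ hq (iInter_subset _ i) hξ)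

theorem QOpen.inter {C : Capacity X} {q γ : ℝ} (hq : 1 ≤ q) {D U : Set X}
    (hD : C.QOpen q γ D) (hU : C.QOpen q γ U) : C.QOpen q γ (D ∩ U) := by
  intro ξ hξ
  rw [compl_inter] at hξ ⊢
  exact (C.thick_union_subset γ hq _ _ hξ).imp (@hD ξ) (@hU ξ)

theorem qOpen_of_isOpen (C : Capacity X) (hfin : C.toFun univ ≠ ⊤) {q : ℝ} (γ : ℝ)
    (hq : 1 < q) {U : Set X} (hU : IsOpen U) : C.QOpen q γ U :=
  C.qClosed_of_isClosed hfin γ hq hU.isClosed_compl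

theorem QOpen.diff_null {C : Capacity X} {q γ : ℝ} (hq : 1 ≤ q) {Q A : Set X}
    (hQ : C.QOpen q γ Q) (hA : C.toFun A = 0) : C.QOpen q γ (Q \ A) := by
  have hsub : C.Subq (Q \ A)ᶜ Qᶜ :=
    le_antisymm (hA ▸ C.mono' fun x hx => by
      by_contra hxA
      exact hx.1 ⟨not_not.1 hx.2, hxA⟩) zero_le
  exact (C.thick_subset_of_subq γ hq hsub).trans
    (hQ.trans (compl_subset_compl.2 sdiff_subset))

variable [CompactSpace X] [MeasurableSpace X] [BorelSpace X] {C : Capacity X} {q γ : ℝ}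

theorem Admissible.upperSemicontinuous_inter_closedBall (hC : C.Admissible q γ) {K : Set X}
    (hK : IsCompact K) (r : ℝ) : UpperSemicontinuous fun ξ => C.toFun (K ∩ closedBall ξ r) := by
  intro ξ t ht
  change C.toFun _ < t at ht
  rw [hC.outerRegular] at ht
  simp only [iInf_lt_iff] at ht
  obtain ⟨G, hKG, hG, hGt⟩ := ht
  have hopen : IsOpen {η : X | ∀ x ∈ K \ G, η ∈ (closedBall x r)ᶜ} := by
    have hKG' : IsCompact (K \ G) := hK.diff hG
    have hc : IsClosed {p : X × X | p.1 ∈ K \ G ∧ dist p.2 p.1 ≤ r} :=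
      (hKG'.isClosed.preimage continuous_fst).inter
        (isClosed_le (continuous_snd.dist continuous_fst) continuous_const)
    convert (isClosedMap_snd_of_compactSpace _ hc).isOpen_compl using 1
    ext η
    simp
  filter_upwards [hopen.mem_nhds (x := ξ) fun x hx hxb =>
    hx.2 (hKG ⟨hx.1, mem_closedBall_comm.1 hxb⟩)] with η hη
  refine (C.mono' fun x hx => ?_).trans_lt hGt
  by_contra hxG
  exact hη x ⟨hx.1, hxG⟩ (mem_closedBall_comm.1 hx.2)

theorem QuasiClosed.measurableSet_thick (hC : C.Admissible q γ) {E : Set X}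
    (hE : C.QuasiClosed E) : MeasurableSet (C.thick q γ E) := by
  obtain ⟨K, -, hK, hKE, hlim⟩ := hE
  have hsup (S : Set X) : C.toFun (E ∩ S) = ⨆ m, C.toFun (K m ∩ S) := by
    refine le_antisymm ?_ (iSup_le fun m => C.mono' (inter_subset_inter_left _ (hKE m)))
    have h := (tendsto_const_nhds (x := ⨆ m, C.toFun (K m ∩ S))).add hlim
    rw [add_zero] at h
    refine ge_of_tendsto' h fun m => ?_
    have hsub : E ∩ S ⊆ (K m ∩ S) ∪ (E \ K m) := fun x hx => by
      by_cases hB : x ∈ K m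
      · exact Or.inl ⟨hB, hx.2⟩
      · exact Or.inr ⟨hx.1, hB⟩
    exact (C.le_add_of_subset_union hsub).trans
      (add_le_add_left (le_iSup (fun m => C.toFun (K m ∩ S)) m) _)
  have hmeas (n : ℕ) :
      Measurable fun ξ => C.toFun (E ∩ closedBall ξ ((2 : ℝ) ^ (-(n : ℝ)))) := by
    simp only [hsup]
    exact Measurable.iSup fun m =>
      (hC.upperSemicontinuous_inter_closedBall (hK m) _).measurable
  exact measurableSet_eq_fun
    (Measurable.tsum fun n => ((hmeas n).const_mul _).pow_const _) measurable_const

theorem Admissible.exists_null_measurableSet_superset (hC : C.Admissible q γ) {A : Set X}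
    (hA : C.toFun A = 0) : ∃ Z, A ⊆ Z ∧ MeasurableSet Z ∧ C.toFun Z = 0 := by
  have h (n : ℕ) : ∃ G, A ⊆ G ∧ IsOpen G ∧ C.toFun G < (n : ℝ≥0∞)⁻¹ := by
    have hn : C.toFun A < (n : ℝ≥0∞)⁻¹ := by simp [hA]
    rw [hC.outerRegular] at hn
    simpa only [iInf_lt_iff, exists_prop] using hn
  choose G hAG hG hlt using h
  refine ⟨⋂ n, G n, subset_iInter hAG, .iInter fun n => (hG n).measurableSet, ?_⟩
  refine le_antisymm (ge_of_tendsto' ENNReal.tendsto_inv_nat_nhds_zero fun n => ?_) zero_le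
  exact (C.mono' (iInter_subset _ n)).trans (hlt n).le

/-- A `q`-open set has a Borel `q`-open superset of the same measure. -/
theorem QOpen.exists_measurableSet_superset (hC : C.Admissible q γ) (hq : 1 ≤ q)
    {μ : Measure X} (hμ : C.EssAbsCont q γ μ) {Q : Set X} (hQ : C.QOpen q γ Q) :
    ∃ D, Q ⊆ D ∧ MeasurableSet D ∧ C.QOpen q γ D ∧ μ D = μ Q := by
  have hD : C.QOpen q γ (C.thick q γ Qᶜ)ᶜ := by
    rw [QOpen, compl_compl]
    exact C.thick_mono γ hq hQ
  obtain ⟨Z, hZsub, hZ, hZ0⟩ := hC.exists_null_measurableSet_superset (hC.kellogg Qᶜ)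
  have hQD : Q ⊆ (C.thick q γ Qᶜ)ᶜ := subset_compl_comm.1 hQ
  refine ⟨_, hQD, ((hC.stratification _ hQ).measurableSet_thick hC).compl, hD, ?_⟩
  refine le_antisymm ?_ (measure_mono hQD)
  rw [← hμ _ hD Z hZ hZ0]
  refine measure_mono fun x hx => ?_
  by_contra hxQ
  exact hx.2 (hZsub ⟨hxQ, hx.1⟩)

theorem qOpen_empty (hC : C.Admissible q γ) (hq : 1 < q) : C.QOpen q γ ∅ :=
  C.qOpen_of_isOpen hC.finite γ hq isOpen_empty

/-- The outer measure `E ↦ inf {μ D : E ⊆ D, D q-open}`. -/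
def qOuter (hC : C.Admissible q γ) (hq : 1 < q) (μ : Measure X) : OuterMeasure X :=
  inducedOuterMeasure (fun D (_ : C.QOpen q γ D) => μ D) (qOpen_empty hC hq) measure_empty

theorem qOuter_apply (hC : C.Admissible q γ) (hq : 1 < q) (μ : Measure X) (E : Set X) :
    qOuter hC hq μ E = ⨅ (D : Set X) (_ : E ⊆ D) (_ : C.QOpen q γ D), μ D := by
  rw [qOuter, inducedOuterMeasure_eq_iInf (fun _ h => QOpen.iUnion hq.le h)
    (fun _ _ => measure_iUnion_le _) (fun _ _ _ _ h => measure_mono h)]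
  exact iInf_congr fun D => iInf_comm

theorem qOuter_apply_of_qOpen (hC : C.Admissible q γ) (hq : 1 < q) (μ : Measure X) {Q : Set X}
    (hQ : C.QOpen q γ Q) : qOuter hC hq μ Q = μ Q := by
  rw [qOuter_apply]
  exact le_antisymm (iInf₂_le_of_le Q Subset.rfl (iInf_le _ hQ))
    (le_iInf₂ fun D hD => le_iInf fun _ => measure_mono hD)

theorem qOuter_le (hC : C.Admissible q γ) (hq : 1 < q) (μ : Measure X) {E D : Set X}
    (hED : E ⊆ D) (hD : C.QOpen q γ D) : qOuter hC hq μ E ≤ μ D :=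
  (measure_mono hED).trans (qOuter_apply_of_qOpen hC hq μ hD).le

theorem qOuter_isMetric (hC : C.Admissible q γ) (hq : 1 < q) (μ : Measure X) :
    (qOuter hC hq μ).IsMetric := by
  rintro s t ⟨r, hr, hst⟩
  refine le_antisymm (measure_union_le s t) ?_
  rw [qOuter_apply hC hq μ (s ∪ t)]
  refine le_iInf₂ fun D hD => le_iInf fun hQ => ?_
  let U := ⋃ x ∈ s, Metric.eball x (r / 2)
  let V := ⋃ y ∈ t, Metric.eball y (r / 2)
  have hr2 : 0 < r / 2 := ENNReal.half_pos hr
  have hU : IsOpen U := isOpen_biUnion fun _ _ => Metric.isOpen_eball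
  have hV : IsOpen V := isOpen_biUnion fun _ _ => Metric.isOpen_eball
  have hdisj : Disjoint U V := by
    refine Set.disjoint_left.2 fun z hzU hzV => ?_
    simp only [U, V, mem_iUnion, Metric.mem_eball, exists_prop] at hzU hzV
    obtain ⟨x, hx, hzx⟩ := hzU
    obtain ⟨y, hy, hzy⟩ := hzV
    refine (hst x hx y hy).not_gt ((edist_triangle_left x y z).trans_lt ?_)
    exact (ENNReal.add_lt_add hzx hzy).trans_eq (ENNReal.add_halves r)
  calc qOuter hC hq μ s + qOuter hC hq μ t ≤ μ (D ∩ U) + μ (D ∩ V) := by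
        refine add_le_add
          (qOuter_le hC hq μ (subset_inter (subset_union_left.trans hD) fun x hx => ?_)
            (hQ.inter hq.le (C.qOpen_of_isOpen hC.finite γ hq hU)))
          (qOuter_le hC hq μ (subset_inter (subset_union_right.trans hD) fun x hx => ?_)
            (hQ.inter hq.le (C.qOpen_of_isOpen hC.finite γ hq hV)))
        · exact mem_biUnion hx (Metric.mem_eball_self hr2)
        · exact mem_biUnion hx (Metric.mem_eball_self hr2)
    _ ≤ μ (D ∩ U) + μ (D \ U) := by
        gcongr
        exact fun x hx => ⟨hx.1, fun hxU => Set.disjoint_left.1 hdisj hxU hx.2⟩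
    _ = μ D := measure_inter_add_sdiff D hU.measurableSet

/-- The Borel measure `E ↦ inf {μ D : E ⊆ D, D q-open}`. -/
def qMeasure (hC : C.Admissible q γ) (hq : 1 < q) (μ : Measure X) : Measure X :=
  (qOuter hC hq μ).toMeasure
    (qOuter_isMetric hC hq μ).le_caratheodory

theorem qMeasure_apply (hC : C.Admissible q γ) (hq : 1 < q) (μ : Measure X) {E : Set X}
    (hE : MeasurableSet E) :
    qMeasure hC hq μ E = ⨅ (D : Set X) (_ : E ⊆ D) (_ : C.QOpen q γ D), μ D := by
  rw [qMeasure, toMeasure_apply _ _ hE, qOuter_apply]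

theorem le_qMeasure (hC : C.Admissible q γ) (hq : 1 < q) (μ : Measure X) :
    μ ≤ qMeasure hC hq μ :=
  Measure.le_iff.2 fun E hE => by
    rw [qMeasure_apply hC hq μ hE]
    exact le_iInf₂ fun D hD => le_iInf fun _ => measure_mono hD

theorem qMeasure_apply_of_qOpen (hC : C.Admissible q γ) (hq : 1 < q) {μ : Measure X}
    (hμ : C.EssAbsCont q γ μ) {Q : Set X} (hQ : C.QOpen q γ Q) :
    qMeasure hC hq μ Q = μ Q := by
  refine le_antisymm ?_ (le_qMeasure hC hq μ Q)
  obtain ⟨D, hQD, hDm, hD, hμD⟩ := hQ.exists_measurableSet_superset hC hq.le hμ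
  rw [← hμD]
  refine (measure_mono hQD).trans ?_
  rw [qMeasure_apply hC hq μ hDm]
  exact iInf₂_le_of_le D Subset.rfl (iInf_le _ hD)

theorem qMeasure_apply_inter (hC : C.Admissible q γ) (hq : 1 < q) {μ : Measure X}
    (hμ : C.EssAbsCont q γ μ) {Q : Set X} (hQ : C.QOpen q γ Q) (hfin : μ Q < ⊤) {B : Set X}
    (hB : MeasurableSet B) : qMeasure hC hq μ (B ∩ Q) = μ (B ∩ Q) := by
  have hle := le_qMeasure hC hq μ
  refine le_antisymm ?_ (hle _)
  rw [inter_comm]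
  have hne : μ (Q \ B) ≠ ⊤ := ((measure_mono sdiff_subset).trans_lt hfin).ne
  refine (ENNReal.add_le_add_iff_right hne).1 ?_
  calc qMeasure hC hq μ (Q ∩ B) + μ (Q \ B)
      ≤ qMeasure hC hq μ (Q ∩ B) + qMeasure hC hq μ (Q \ B) := by gcongr
    _ = μ (Q ∩ B) + μ (Q \ B) := by
        rw [measure_inter_add_sdiff Q hB, measure_inter_add_sdiff Q hB,
          qMeasure_apply_of_qOpen hC hq hμ hQ]

theorem qPerfect_qMeasure (hC : C.Admissible q γ) (hq : 1 < q) {μ : Measure X}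
    (hμ : C.EssAbsCont q γ μ) : C.QPerfect q γ (qMeasure hC hq μ) := by
  refine ⟨fun E hE => ?_, fun Q hQ A hA hA0 => ?_⟩
  · rw [qMeasure_apply hC hq μ hE]
    exact iInf_congr fun D => iInf_congr fun _ => iInf_congr fun hD =>
      (qMeasure_apply_of_qOpen hC hq hμ hD).symm
  · rw [qMeasure_apply_of_qOpen hC hq hμ hQ,
      qMeasure_apply_of_qOpen hC hq hμ (hQ.diff_null hq.le hA0), hμ Q hQ A hA hA0]

theorem qMeasure_le (hC : C.Admissible q γ) (hq : 1 < q) {μ ν : Measure X}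
    (hν : C.OuterRegularQ q γ ν) (hle : μ ≤ ν) {E : Set X} (hE : MeasurableSet E) :
    qMeasure hC hq μ E ≤ ν E := by
  rw [qMeasure_apply hC hq μ hE, hν E hE]
  exact iInf_mono fun D => iInf_mono fun _ => iInf_mono fun _ => hle D

end Capacity

theorem stmt19 {X : Type*} [MetricSpace X] [CompactSpace X] [MeasurableSpace X] [BorelSpace X]
    (N : ℕ) (hN : 2 ≤ N) (q γ : ℝ) (hq : ((N : ℝ) + 1) / ((N : ℝ) - 1) ≤ q)
    (hγ : γ = (N : ℝ) - 1 - 2 / (q - 1))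
    (C : Capacity X) (hC : C.Admissible q γ)
    (μ₀ : Measure X) (hμ₀ : C.EssAbsCont q γ μ₀) :
    ∃ μ : Measure X,
      (∀ E : Set X, MeasurableSet E →
        μ E = ⨅ (D : Set X) (_ : E ⊆ D) (_ : C.QOpen q γ D), μ₀ D) ∧
      (∀ E : Set X, MeasurableSet E → μ₀ E ≤ μ E) ∧
      (∀ Q : Set X, C.QOpen q γ Q → μ Q = μ₀ Q) ∧
      (∀ Q : Set X, C.QOpen q γ Q → μ₀ Q < ⊤ →
        ∀ B : Set X, MeasurableSet B → μ (B ∩ Q) = μ₀ (B ∩ Q)) ∧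
      C.QPerfect q γ μ ∧
      (∀ ν : Measure X, C.QPerfect q γ ν →
        (∀ E : Set X, MeasurableSet E → μ₀ E ≤ ν E) →
        ∀ E : Set X, MeasurableSet E → μ E ≤ ν E) := by
  have hq1 : 1 < q := by
    have hN' : (2 : ℝ) ≤ N := by exact_mod_cast hN
    refine lt_of_lt_of_le ?_ hq
    rw [lt_div_iff₀ (by linarith)]
    linarith
  refine ⟨Capacity.qMeasure hC hq1 μ₀, fun E hE => Capacity.qMeasure_apply hC hq1 μ₀ hE,
    fun E _ => Capacity.le_qMeasure hC hq1 μ₀ E,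
    fun Q hQ => Capacity.qMeasure_apply_of_qOpen hC hq1 hμ₀ hQ,
    fun Q hQ hfin B hB => Capacity.qMeasure_apply_inter hC hq1 hμ₀ hQ hfin hB,
    Capacity.qPerfect_qMeasure hC hq1 hμ₀,
    fun ν hν hle E hE => Capacity.qMeasure_le hC hq1 hν.1 (Measure.le_iff.2 hle) hE⟩
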